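/- arXiv:math/0701352 — 4 statements merged into one kernel-verified Lean document; each statement's English description precedes it below -/
import Mathlib

section
/- For every real p with 0 < p ≤ 1, the function Φ_p is jointly concave: for any n-tuples (A_1,…,A_n) and (B_1,…,B_n) of positive semidefinite d×d complex matrices and any t ∈ [0,1], one has Tr((∑_{j=1}^n (t·A_j + (1−t)·B_j)^p)^{1/p}) ≥ t·Tr((∑_{j=1}^n A_j^p)^{1/p}) + (1−t)·Tr((∑_{j=1}^n B_j^p)^{1/p}). -/
open Matrix
open scoped ComplexOrder

/-- Matrix power via the functional calculus: for a Hermitian matrix, apply the real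
power `x ^ s` to the eigenvalues in its spectral decomposition (so `0 ^ s = 0` for `s > 0`);
junk value `0` for non-Hermitian matrices. -/
noncomputable def matrixRpow {n : Type*} [Fintype n] [DecidableEq n]
    (A : Matrix n n ℂ) (s : ℝ) : Matrix n n ℂ :=
  if h : A.IsHermitian then
    (h.eigenvectorUnitary : Matrix n n ℂ) *
      Matrix.diagonal (fun i => ((h.eigenvalues i ^ s : ℝ) : ℂ)) *
        (star h.eigenvectorUnitary : Matrix n n ℂ)
  else 0

section MatrixRpow

variable {m : Type*} [Fintype m] [DecidableEq m]

lemma matrixRpow_eq_cfc {A : Matrix m m ℂ} (hA : A.IsHermitian) (s : ℝ) :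
    matrixRpow A s = cfc (fun x : ℝ => x ^ s) A := by
  rw [matrixRpow, dif_pos hA, hA.cfc_eq, IsHermitian.cfc, Unitary.conjStarAlgAut_apply]
  rfl

lemma matrixRpow_one {A : Matrix m m ℂ} (hA : A.IsHermitian) : matrixRpow A 1 = A := by
  simp only [matrixRpow_eq_cfc hA, Real.rpow_one]
  exact cfc_id' ℝ A hA

lemma matrixRpow_zero {A : Matrix m m ℂ} (hA : A.IsHermitian) : matrixRpow A 0 = 1 := by
  simp only [matrixRpow_eq_cfc hA, Real.rpow_zero]
  exact cfc_const_one ℝ A hA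

lemma posSemidef_matrixRpow {A : Matrix m m ℂ} (hA : A.PosSemidef) (s : ℝ) :
    (matrixRpow A s).PosSemidef := by
  rw [matrixRpow, dif_pos hA.1]
  refine PosSemidef.mul_mul_conjTranspose_same (PosSemidef.diagonal fun i => ?_) _
  exact Complex.zero_le_real.2 <| Real.rpow_nonneg (hA.eigenvalues_nonneg i) s

lemma spectrum_nonneg_of_posSemidef {A : Matrix m m ℂ} (hA : A.PosSemidef) {x : ℝ}
    (hx : x ∈ spectrum ℝ A) : 0 ≤ x := by
  obtain ⟨i, rfl⟩ := hA.1.spectrum_real_eq_range_eigenvalues ▸ hx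
  exact hA.eigenvalues_nonneg i

lemma finite_spectrum_of_isHermitian {A : Matrix m m ℂ} (hA : A.IsHermitian) :
    (spectrum ℝ A).Finite := by
  rw [hA.spectrum_real_eq_range_eigenvalues]
  exact Set.finite_range _

lemma matrixRpow_matrixRpow {A : Matrix m m ℂ} (hA : A.PosSemidef) (r s : ℝ) :
    matrixRpow (matrixRpow A r) s = matrixRpow A (r * s) := by
  have hfin := finite_spectrum_of_isHermitian hA.1
  rw [matrixRpow_eq_cfc (posSemidef_matrixRpow hA r).1, matrixRpow_eq_cfc hA.1,
    matrixRpow_eq_cfc hA.1, ← cfc_comp' (fun x : ℝ => x ^ s) (fun x : ℝ => x ^ r) A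
      ((hfin.image _).continuousOn _) (hfin.continuousOn _) hA.1.isSelfAdjoint]
  exact cfc_congr fun x hx => (Real.rpow_mul (spectrum_nonneg_of_posSemidef hA hx) r s).symm

lemma matrixRpow_mul_matrixRpow {A : Matrix m m ℂ} (hA : A.PosSemidef) {r s : ℝ}
    (hrs : r + s ≠ 0) : matrixRpow A r * matrixRpow A s = matrixRpow A (r + s) := by
  have hfin := finite_spectrum_of_isHermitian hA.1
  rw [matrixRpow_eq_cfc hA.1, matrixRpow_eq_cfc hA.1, matrixRpow_eq_cfc hA.1,
    ← cfc_mul _ _ A (hfin.continuousOn _) (hfin.continuousOn _)]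
  exact cfc_congr fun x hx => (Real.rpow_add' (spectrum_nonneg_of_posSemidef hA hx) hrs).symm

/-- The matrix `Y` written in the eigenbases of `A` (rows) and `B` (columns). -/
noncomputable def eigenCoeff {A B : Matrix m m ℂ} (hA : A.IsHermitian) (hB : B.IsHermitian)
    (Y : Matrix m m ℂ) : Matrix m m ℂ :=
  (star hA.eigenvectorUnitary : Matrix m m ℂ) * Y * (hB.eigenvectorUnitary : Matrix m m ℂ)

lemma trace_conjTranspose_diagonal_mul_diagonal (M : Matrix m m ℂ) (a b : m → ℝ) :
    (Mᴴ * diagonal (fun i => (a i : ℂ)) * M * diagonal (fun i => (b i : ℂ))).trace.re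
      = ∑ i, ∑ k, a i * b k * ‖M i k‖ ^ 2 := by
  rw [Finset.sum_comm]
  simp only [trace, diag_apply, mul_diagonal, Complex.re_sum]
  refine Finset.sum_congr rfl fun k _ => ?_
  rw [mul_apply, Finset.sum_mul, Complex.re_sum]
  refine Finset.sum_congr rfl fun i _ => ?_
  rw [mul_diagonal, conjTranspose_apply, ← Complex.normSq_eq_norm_sq]
  simp [Complex.normSq_apply]
  ring

lemma trace_mul_matrixRpow_mul_matrixRpow {A B : Matrix m m ℂ} (hA : A.IsHermitian)
    (hB : B.IsHermitian) (Y : Matrix m m ℂ) (r s : ℝ) :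
    (Yᴴ * matrixRpow A r * Y * matrixRpow B s).trace.re
      = ∑ i, ∑ k, hA.eigenvalues i ^ r * hB.eigenvalues k ^ s * ‖eigenCoeff hA hB Y i k‖ ^ 2 := by
  rw [← trace_conjTranspose_diagonal_mul_diagonal, matrixRpow, dif_pos hA, matrixRpow, dif_pos hB,
    eigenCoeff]
  simp only [conjTranspose_mul, star_eq_conjTranspose, conjTranspose_conjTranspose, ← mul_assoc]
  rw [trace_mul_comm]
  simp only [← mul_assoc]

lemma trace_conjTranspose_mul_mul {A B : Matrix m m ℂ} (hA : A.IsHermitian)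
    (hB : B.IsHermitian) (Y : Matrix m m ℂ) :
    (Yᴴ * A * Y).trace.re
      = ∑ i, ∑ k, hA.eigenvalues i * ‖eigenCoeff hA hB Y i k‖ ^ 2 := by
  simpa [matrixRpow_one hA, matrixRpow_zero hB] using
    trace_mul_matrixRpow_mul_matrixRpow hA hB Y 1 0

lemma trace_conjTranspose_mul_self_mul {A B : Matrix m m ℂ} (hA : A.IsHermitian)
    (hB : B.IsHermitian) (Y : Matrix m m ℂ) :
    (Yᴴ * Y * B).trace.re
      = ∑ i, ∑ k, hB.eigenvalues k * ‖eigenCoeff hA hB Y i k‖ ^ 2 := by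
  simpa [matrixRpow_zero hA, matrixRpow_one hB] using
    trace_mul_matrixRpow_mul_matrixRpow hA hB Y 0 1

lemma trace_matrixRpow_mul_matrixRpow {A B : Matrix m m ℂ} (hA : A.IsHermitian)
    (hB : B.IsHermitian) (r s : ℝ) :
    (matrixRpow A r * matrixRpow B s).trace.re
      = ∑ i, ∑ k, hA.eigenvalues i ^ r * hB.eigenvalues k ^ s * ‖eigenCoeff hA hB 1 i k‖ ^ 2 := by
  simpa using trace_mul_matrixRpow_mul_matrixRpow hA hB 1 r s

/-- Young's inequality for traces. -/
lemma trace_matrixRpow_mul_matrixRpow_le {A B : Matrix m m ℂ} (hA : A.PosSemidef)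
    (hB : B.PosSemidef) {p : ℝ} (hp0 : 0 ≤ p) (hp1 : p ≤ 1) :
    (matrixRpow A p * matrixRpow B (1 - p)).trace.re
      ≤ p * A.trace.re + (1 - p) * B.trace.re := by
  have h1 := trace_conjTranspose_mul_mul hA.1 hB.1 1
  have h2 := trace_conjTranspose_mul_self_mul hA.1 hB.1 1
  simp only [conjTranspose_one, one_mul, mul_one] at h1 h2
  rw [trace_matrixRpow_mul_matrixRpow hA.1 hB.1, h1, h2]
  simp only [Finset.mul_sum, ← Finset.sum_add_distrib]
  refine Finset.sum_le_sum fun i _ => Finset.sum_le_sum fun k _ => ?_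
  rw [← mul_assoc, ← mul_assoc, ← add_mul]
  gcongr
  exact Real.geom_mean_le_arith_mean2_weighted hp0 (by linarith) (hA.eigenvalues_nonneg i)
    (hB.eigenvalues_nonneg k) (by ring)

/-- The quadratic functional whose infimum over `Y` is the trace of the parallel sum of left
multiplication by `A` and right multiplication by `c • B`. -/
noncomputable def parallelForm (c : ℝ) (A B Y : Matrix m m ℂ) : ℝ :=
  (Yᴴ * A * Y).trace.re + c * ((1 - Y)ᴴ * (1 - Y) * B).trace.re

/-- The trace of the parallel sum of left multiplication by `A` and right multiplication by
`c • B`, in terms of eigenvalues. -/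
noncomputable def parallelTrace (c : ℝ) {A B : Matrix m m ℂ} (hA : A.IsHermitian)
    (hB : B.IsHermitian) : ℝ :=
  ∑ i, ∑ k, hA.eigenvalues i * (c * hB.eigenvalues k) /
    (hA.eigenvalues i + c * hB.eigenvalues k) * ‖eigenCoeff hA hB 1 i k‖ ^ 2

lemma parallelForm_eq_sum (c : ℝ) {A B : Matrix m m ℂ} (hA : A.IsHermitian)
    (hB : B.IsHermitian) (Y : Matrix m m ℂ) :
    parallelForm c A B Y = ∑ i, ∑ k, (hA.eigenvalues i * ‖eigenCoeff hA hB Y i k‖ ^ 2 +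
      c * hB.eigenvalues k * ‖eigenCoeff hA hB 1 i k - eigenCoeff hA hB Y i k‖ ^ 2) := by
  have h : ∀ i k, eigenCoeff hA hB (1 - Y) i k
      = eigenCoeff hA hB 1 i k - eigenCoeff hA hB Y i k := fun i k => by
    simp only [eigenCoeff, mul_sub, sub_mul, Matrix.sub_apply]
  rw [parallelForm, trace_conjTranspose_mul_mul hA hB, trace_conjTranspose_mul_self_mul hA hB]
  simp only [h, Finset.mul_sum, ← Finset.sum_add_distrib, mul_assoc]

lemma mul_div_add_mul_norm_sq_le {a b : ℝ} (ha : 0 ≤ a) (hb : 0 ≤ b) (x y : ℂ) :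
    a * b / (a + b) * ‖x‖ ^ 2 ≤ a * ‖y‖ ^ 2 + b * ‖x - y‖ ^ 2 := by
  rcases (add_nonneg ha hb).eq_or_lt with h | h
  · rw [← h]; simp; positivity
  have hx : ‖x‖ ≤ ‖y‖ + ‖x - y‖ := by simpa using norm_add_le y (x - y)
  calc a * b / (a + b) * ‖x‖ ^ 2 ≤ a * b / (a + b) * (‖y‖ + ‖x - y‖) ^ 2 := by gcongr
    _ ≤ a * ‖y‖ ^ 2 + b * ‖x - y‖ ^ 2 := by
      rw [div_mul_eq_mul_div, div_le_iff₀ h]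
      nlinarith [sq_nonneg (a * ‖y‖ - b * ‖x - y‖)]

lemma parallelTrace_le_parallelForm {c : ℝ} (hc : 0 ≤ c) {A B : Matrix m m ℂ}
    (hA : A.PosSemidef) (hB : B.PosSemidef) (Y : Matrix m m ℂ) :
    parallelTrace c hA.1 hB.1 ≤ parallelForm c A B Y := by
  rw [parallelForm_eq_sum c hA.1 hB.1]
  exact Finset.sum_le_sum fun i _ => Finset.sum_le_sum fun k _ =>
    mul_div_add_mul_norm_sq_le (hA.eigenvalues_nonneg i)
      (mul_nonneg hc (hB.eigenvalues_nonneg k)) _ _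

lemma exists_parallelForm_eq_parallelTrace {c : ℝ} (hc : 0 ≤ c) {A B : Matrix m m ℂ}
    (hA : A.PosSemidef) (hB : B.PosSemidef) :
    ∃ Y, parallelForm c A B Y = parallelTrace c hA.1 hB.1 := by
  set N : Matrix m m ℂ := of fun i k =>
    ((c * hB.1.eigenvalues k / (hA.1.eigenvalues i + c * hB.1.eigenvalues k) : ℝ) : ℂ) *
      eigenCoeff hA.1 hB.1 1 i k with hN
  refine ⟨(hA.1.eigenvectorUnitary : Matrix m m ℂ) * N *
    (star hB.1.eigenvectorUnitary : Matrix m m ℂ), ?_⟩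
  have hY : eigenCoeff hA.1 hB.1 ((hA.1.eigenvectorUnitary : Matrix m m ℂ) * N *
      (star hB.1.eigenvectorUnitary : Matrix m m ℂ)) = N := by
    rw [eigenCoeff]
    simp only [mul_assoc, Unitary.coe_star_mul_self, mul_one]
    rw [← mul_assoc, Unitary.coe_star_mul_self, one_mul]
  rw [parallelForm_eq_sum c hA.1 hB.1, parallelTrace, hY]
  refine Finset.sum_congr rfl fun i _ => Finset.sum_congr rfl fun k _ => ?_
  have ha := hA.eigenvalues_nonneg i
  have hb := mul_nonneg hc (hB.eigenvalues_nonneg k)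
  simp only [hN, of_apply]
  set a := hA.1.eigenvalues i
  set b := c * hB.1.eigenvalues k
  set x := eigenCoeff hA.1 hB.1 1 i k
  have hx : x - ((b / (a + b) : ℝ) : ℂ) * x = ((1 - b / (a + b) : ℝ) : ℂ) * x := by
    push_cast; ring
  rw [hx, norm_mul, norm_mul, mul_pow, mul_pow, Complex.norm_real, Complex.norm_real,
    Real.norm_eq_abs, Real.norm_eq_abs, sq_abs, sq_abs]
  rcases (add_nonneg ha hb).eq_or_lt with h | h
  · have ha0 : a = 0 := by linarith
    have hb0 : b = 0 := by linarith
    simp [ha0, hb0]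
  · field_simp
    ring

lemma parallelForm_combo (c t : ℝ) (A A' B B' Y : Matrix m m ℂ) :
    parallelForm c (t • A + (1 - t) • A') (t • B + (1 - t) • B') Y
      = t * parallelForm c A B Y + (1 - t) * parallelForm c A' B' Y := by
  simp only [parallelForm, mul_add, add_mul, mul_smul_comm, smul_mul_assoc, trace_add, trace_smul,
    Complex.add_re, Complex.smul_re, smul_eq_mul]
  ring

lemma parallelTrace_concave {c : ℝ} (hc : 0 ≤ c) {A A' B B' : Matrix m m ℂ}
    (hA : A.PosSemidef) (hA' : A'.PosSemidef) (hB : B.PosSemidef) (hB' : B'.PosSemidef)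
    {t : ℝ} (ht0 : 0 ≤ t) (ht1 : t ≤ 1)
    (hAt : (t • A + (1 - t) • A').PosSemidef) (hBt : (t • B + (1 - t) • B').PosSemidef) :
    t * parallelTrace c hA.1 hB.1 + (1 - t) * parallelTrace c hA'.1 hB'.1
      ≤ parallelTrace c hAt.1 hBt.1 := by
  obtain ⟨Y, hY⟩ := exists_parallelForm_eq_parallelTrace hc hAt hBt
  rw [← hY, parallelForm_combo]
  have := sub_nonneg.2 ht1
  gcongr
  exacts [parallelTrace_le_parallelForm hc hA hB Y, parallelTrace_le_parallelForm hc hA' hB' Y]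

open MeasureTheory Set Real in
lemma rpow_mul_rpow_mul_const_eq_integral {p : ℝ} (hp : p ∈ Ioo (0 : ℝ) 1) {a b : ℝ}
    (ha : 0 ≤ a) (hb : 0 ≤ b) :
    IntegrableOn (fun c : ℝ => c ^ (p - 2) * (a * (c * b) / (a + c * b))) (Ioi 0) ∧
    ∫ c in Ioi (0 : ℝ), c ^ (p - 2) * (a * (c * b) / (a + c * b))
      = a ^ p * b ^ (1 - p) * ∫ c in Ioi (0 : ℝ), rpowIntegrand₀₁ p c 1 := by
  have hEq : EqOn (fun c : ℝ => c ^ (p - 2) * (a * (c * b) / (a + c * b)))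
      (fun c => b * rpowIntegrand₀₁ p c (a / b)) (Ioi 0) := by
    intro c (hc : 0 < c)
    simp only
    rw [rpowIntegrand₀₁_eq_pow_div hp hc.le (div_nonneg ha hb)]
    rcases hb.eq_or_lt with rfl | hb
    · simp
    have h1 : c ^ (p - 1) = c ^ (p - 2) * c := by
      rw [← rpow_add_one hc.ne']; ring_nf
    rw [h1]
    have : 0 < a + c * b := by positivity
    have : 0 < c + a / b := by positivity
    field_simp
    ring
  refine ⟨IntegrableOn.congr_fun
    ((integrableOn_rpowIntegrand₀₁_Ioi hp (div_nonneg ha hb)).const_mul b) hEq.symm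
      measurableSet_Ioi, ?_⟩
  rw [setIntegral_congr_fun measurableSet_Ioi hEq, integral_const_mul,
    integral_rpowIntegrand₀₁_eq_rpow_mul_const hp (div_nonneg ha hb), ← mul_assoc]
  congr 1
  rcases hb.eq_or_lt with rfl | hb
  · simp [zero_rpow (sub_pos.2 hp.2).ne']
  rw [div_rpow ha hb.le, rpow_sub hb, rpow_one]
  ring

open MeasureTheory Set Real in
lemma trace_mul_const_eq_integral_parallelTrace {p : ℝ} (hp : p ∈ Ioo (0 : ℝ) 1)
    {A B : Matrix m m ℂ} (hA : A.PosSemidef) (hB : B.PosSemidef) :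
    IntegrableOn (fun c : ℝ => c ^ (p - 2) * parallelTrace c hA.1 hB.1) (Ioi 0) ∧
    ∫ c in Ioi (0 : ℝ), c ^ (p - 2) * parallelTrace c hA.1 hB.1
      = (matrixRpow A p * matrixRpow B (1 - p)).trace.re *
        ∫ c in Ioi (0 : ℝ), rpowIntegrand₀₁ p c 1 := by
  have h := fun i k => rpow_mul_rpow_mul_const_eq_integral hp (hA.eigenvalues_nonneg i)
    (hB.eigenvalues_nonneg k)
  have hint := fun i k => (h i k).1.mul_const (‖eigenCoeff hA.1 hB.1 1 i k‖ ^ 2)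
  simp only [parallelTrace, Finset.mul_sum, ← mul_assoc] at hint ⊢
  refine ⟨integrable_finsetSum _ fun i _ => integrable_finsetSum _ fun k _ => hint i k, ?_⟩
  rw [integral_finsetSum _ fun i _ => integrable_finsetSum _ fun k _ => hint i k,
    trace_matrixRpow_mul_matrixRpow hA.1 hB.1, Finset.sum_mul]
  refine Finset.sum_congr rfl fun i _ => ?_
  rw [integral_finsetSum _ fun k _ => hint i k, Finset.sum_mul]
  refine Finset.sum_congr rfl fun k _ => ?_
  have h2 := (h i k).2
  simp only [← mul_assoc] at h2
  rw [integral_mul_const, h2]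
  ring

open MeasureTheory Set Real in
/-- Lieb's concavity theorem for `(A, B) ↦ Tr (A ^ p * B ^ (1 - p))`. -/
lemma trace_matrixRpow_mul_matrixRpow_concave {p : ℝ} (hp0 : 0 < p) (hp1 : p ≤ 1)
    {A A' B B' : Matrix m m ℂ}
    (hA : A.PosSemidef) (hA' : A'.PosSemidef) (hB : B.PosSemidef) (hB' : B'.PosSemidef)
    {t : ℝ} (ht0 : 0 ≤ t) (ht1 : t ≤ 1) :
    t * (matrixRpow A p * matrixRpow B (1 - p)).trace.re
      + (1 - t) * (matrixRpow A' p * matrixRpow B' (1 - p)).trace.re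
    ≤ (matrixRpow (t • A + (1 - t) • A') p *
        matrixRpow (t • B + (1 - t) • B') (1 - p)).trace.re := by
  have hAt : (t • A + (1 - t) • A').PosSemidef := (hA.smul ht0).add (hA'.smul (sub_nonneg.2 ht1))
  have hBt : (t • B + (1 - t) • B').PosSemidef := (hB.smul ht0).add (hB'.smul (sub_nonneg.2 ht1))
  rcases hp1.eq_or_lt with rfl | hp1
  · simp [matrixRpow_one, matrixRpow_zero, hA.1, hA'.1, hB.1, hB'.1, hAt.1, hBt.1]
  have hp : p ∈ Ioo (0 : ℝ) 1 := ⟨hp0, hp1⟩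
  obtain ⟨i1, e1⟩ := trace_mul_const_eq_integral_parallelTrace hp hA hB
  obtain ⟨i2, e2⟩ := trace_mul_const_eq_integral_parallelTrace hp hA' hB'
  obtain ⟨i3, e3⟩ := trace_mul_const_eq_integral_parallelTrace hp hAt hBt
  refine le_of_mul_le_mul_right ?_ (integral_rpowIntegrand₀₁_one_pos hp)
  rw [add_mul, mul_assoc, mul_assoc, ← e1, ← e2, ← e3, ← integral_const_mul,
    ← integral_const_mul, ← integral_add (i1.const_mul t) (i2.const_mul (1 - t))]
  refine setIntegral_mono_on ((i1.const_mul t).add (i2.const_mul (1 - t))) i3 measurableSet_Ioi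
    fun c (hc : 0 < c) => ?_
  calc _ = c ^ (p - 2) *
        (t * parallelTrace c hA.1 hB.1 + (1 - t) * parallelTrace c hA'.1 hB'.1) := by ring
    _ ≤ _ := by
      gcongr
      exact parallelTrace_concave hc.le hA hA' hB hB' ht0 ht1 hAt hBt

end MatrixRpow

/-- **Joint concavity of `Φ_p` for `0 < p ≤ 1`.**
`Φ_p(A_1,…,A_n) = Tr((∑ A_j^p)^{1/p})` is jointly concave on `n`-tuples of positive
semidefinite `d × d` complex matrices. -/
theorem phi_p_concave {d n : ℕ} (p : ℝ) (hp0 : 0 < p) (hp1 : p ≤ 1)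
    (A B : Fin n → Matrix (Fin d) (Fin d) ℂ)
    (hA : ∀ j, (A j).PosSemidef) (hB : ∀ j, (B j).PosSemidef)
    (t : ℝ) (ht0 : 0 ≤ t) (ht1 : t ≤ 1) :
    t * (matrixRpow (∑ j, matrixRpow (A j) p) (1 / p)).trace.re
      + (1 - t) * (matrixRpow (∑ j, matrixRpow (B j) p) (1 / p)).trace.re
    ≤ (matrixRpow (∑ j, matrixRpow (t • A j + (1 - t) • B j) p) (1 / p)).trace.re := by
  have hsum : ∀ {C : Fin n → Matrix (Fin d) (Fin d) ℂ}, (∀ j, (C j).PosSemidef) →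
      (∑ j, matrixRpow (C j) p).PosSemidef := fun hC =>
    posSemidef_sum _ fun j _ => posSemidef_matrixRpow (hC j) p
  have hroot : ∀ {X : Matrix (Fin d) (Fin d) ℂ}, X.PosSemidef →
      matrixRpow (matrixRpow X (1 / p)) p = X := fun hX => by
    rw [matrixRpow_matrixRpow hX, one_div_mul_cancel hp0.ne', matrixRpow_one hX.1]
  have hself : ∀ {C : Fin n → Matrix (Fin d) (Fin d) ℂ}, (∀ j, (C j).PosSemidef) →
      (matrixRpow (∑ j, matrixRpow (C j) p) (1 / p)).trace.re = ∑ j, (matrixRpow (C j) p *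
        matrixRpow (matrixRpow (∑ j, matrixRpow (C j) p) (1 / p)) (1 - p)).trace.re := by
    intro C hC
    have hW := posSemidef_matrixRpow (hsum hC) (1 / p)
    have h := matrixRpow_mul_matrixRpow hW (r := p) (s := 1 - p) (by simp)
    rw [hroot (hsum hC), add_sub_cancel, matrixRpow_one hW.1] at h
    rw [← Complex.re_sum, ← trace_sum, ← Finset.sum_mul, h]
  have hC : ∀ j, (t • A j + (1 - t) • B j).PosSemidef := fun j =>
    ((hA j).smul ht0).add ((hB j).smul (sub_nonneg.2 ht1))
  have hWA := posSemidef_matrixRpow (hsum hA) (1 / p)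
  have hWB := posSemidef_matrixRpow (hsum hB) (1 / p)
  have hWC := posSemidef_matrixRpow (hsum hC) (1 / p)
  have hselfA := hself hA
  have hselfB := hself hB
  have hrootC := hroot (hsum hC)
  set WA := matrixRpow (∑ j, matrixRpow (A j) p) (1 / p)
  set WB := matrixRpow (∑ j, matrixRpow (B j) p) (1 / p)
  set WC := matrixRpow (∑ j, matrixRpow (t • A j + (1 - t) • B j) p) (1 / p)
  have hZ : (t • WA + (1 - t) • WB).PosSemidef :=
    (hWA.smul ht0).add (hWB.smul (sub_nonneg.2 ht1))
  have hlieb : t * WA.trace.re + (1 - t) * WB.trace.re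
      ≤ (matrixRpow WC p * matrixRpow (t • WA + (1 - t) • WB) (1 - p)).trace.re := by
    rw [hselfA, hselfB, hrootC, Finset.sum_mul, trace_sum, Complex.re_sum, Finset.mul_sum,
      Finset.mul_sum, ← Finset.sum_add_distrib]
    exact Finset.sum_le_sum fun j _ =>
      trace_matrixRpow_mul_matrixRpow_concave hp0 hp1 (hA j) (hB j) hWA hWB ht0 ht1
  have hyoung := trace_matrixRpow_mul_matrixRpow_le hWC hZ hp0.le hp1
  have htr : (t • WA + (1 - t) • WB).trace.re = t * WA.trace.re + (1 - t) * WB.trace.re := by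
    simp
  rw [htr] at hyoung
  refine le_of_mul_le_mul_left ?_ hp0
  linarith
end

section
/- The function Φ_2 is jointly convex: for any n-tuples (A_1,…,A_n) and (B_1,…,B_n) of positive semidefinite d×d complex matrices and any t ∈ [0,1], one has Tr((∑_{j=1}^n (t·A_j + (1−t)·B_j)^2)^{1/2}) ≤ t·Tr((∑_{j=1}^n A_j^2)^{1/2}) + (1−t)·Tr((∑_{j=1}^n B_j^2)^{1/2}). -/
open Matrix
open scoped ComplexOrder

namespace Matrix

variable {m n : Type*} [Fintype m] [Fintype n]

/-- The squared norm of a column of `X * V` as a diagonal entry of `Vᴴ * (Xᴴ * X) * V`. -/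
theorem sum_norm_sq_column (X : Matrix m n ℂ) (V : Matrix n n ℂ) (i : n) :
    ∑ k, ‖(X * V) k i‖ ^ 2 = ((Vᴴ * (Xᴴ * X) * V) i i).re := by
  have : Vᴴ * (Xᴴ * X) * V = (X * V)ᴴ * (X * V) := by
    simp only [conjTranspose_mul, Matrix.mul_assoc]
  rw [this, Matrix.mul_apply, Complex.re_sum]
  refine Finset.sum_congr rfl fun k _ => ?_
  rw [conjTranspose_apply, Complex.star_def, ← Complex.normSq_eq_conj_mul_self, Complex.ofReal_re,
    Complex.normSq_eq_norm_sq]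

variable [DecidableEq n]

theorem IsHermitian.eq_eigenvectorUnitary_mul_diagonal {S : Matrix n n ℂ} (h : S.IsHermitian) :
    S = (h.eigenvectorUnitary : Matrix n n ℂ) *
      diagonal (fun i => (h.eigenvalues i : ℂ)) * (h.eigenvectorUnitary : Matrix n n ℂ)ᴴ := by
  have := h.spectral_theorem
  rw [Unitary.conjStarAlgAut_apply] at this
  exact this

theorem conjTranspose_mul_eigenvectorUnitary {S : Matrix n n ℂ} (h : S.IsHermitian) :
    (h.eigenvectorUnitary : Matrix n n ℂ)ᴴ * (h.eigenvectorUnitary : Matrix n n ℂ) = 1 :=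
  Unitary.coe_star_mul_self _

theorem eigenvectorUnitary_mul_conjTranspose {S : Matrix n n ℂ} (h : S.IsHermitian) :
    (h.eigenvectorUnitary : Matrix n n ℂ) * (h.eigenvectorUnitary : Matrix n n ℂ)ᴴ = 1 :=
  Unitary.coe_mul_star_self _

theorem trace_matrixRpow_re {S : Matrix n n ℂ} (h : S.IsHermitian) (s : ℝ) :
    (matrixRpow S s).trace.re = ∑ i, h.eigenvalues i ^ s := by
  have hU := conjTranspose_mul_eigenvectorUnitary h
  rw [← star_eq_conjTranspose] at hU
  rw [matrixRpow, dif_pos h, Matrix.trace_mul_comm, ← Matrix.mul_assoc, hU, Matrix.one_mul,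
    Matrix.trace_diagonal, Complex.re_sum]
  simp only [Complex.ofReal_re]

theorem matrixRpow_two {S : Matrix n n ℂ} (h : S.IsHermitian) : matrixRpow S 2 = S * S := by
  have hU := conjTranspose_mul_eigenvectorUnitary h
  have hS := h.eq_eigenvectorUnitary_mul_diagonal
  rw [matrixRpow, dif_pos h, ← star_eq_conjTranspose] at *
  set U := (h.eigenvectorUnitary : Matrix n n ℂ)
  set D := diagonal (fun i => (h.eigenvalues i : ℂ))
  have hD : diagonal (fun i => ((h.eigenvalues i ^ (2 : ℝ) : ℝ) : ℂ)) = D * D := by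
    simp [D, diagonal_mul_diagonal, pow_two]
  calc _ = U * (D * D) * star U := by rw [hD]
    _ = U * D * (star U * U) * D * star U := by
        rw [hU]
        simp only [Matrix.mul_one, Matrix.mul_assoc]
    _ = (U * D * star U) * (U * D * star U) := by simp only [Matrix.mul_assoc]
    _ = S * S := by rw [← hS]

/-- Duality bound: a contraction pairs with `X` to at most the trace norm of `X`. -/
theorem trace_conjTranspose_mul_re_le {K X : Matrix m n ℂ} (hK : (1 - Kᴴ * K).PosSemidef) :
    (Kᴴ * X).trace.re ≤ (matrixRpow (Xᴴ * X) (1 / 2)).trace.re := by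
  have h : (Xᴴ * X).IsHermitian := isHermitian_conjTranspose_mul_self X
  rw [trace_matrixRpow_re h]
  have hV := conjTranspose_mul_eigenvectorUnitary h
  have hV' := eigenvectorUnitary_mul_conjTranspose h
  have hS := h.eq_eigenvectorUnitary_mul_diagonal
  set V := (h.eigenvectorUnitary : Matrix n n ℂ)
  have htr : (Kᴴ * X).trace = ((K * V)ᴴ * (X * V)).trace := by
    rw [conjTranspose_mul, Matrix.mul_assoc, Matrix.trace_mul_comm Vᴴ, Matrix.mul_assoc,
      Matrix.mul_assoc, hV', Matrix.mul_one]
  rw [htr, Matrix.trace, Complex.re_sum]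
  refine Finset.sum_le_sum fun i _ => ?_
  have hXi : ∑ k, ‖(X * V) k i‖ ^ 2 = h.eigenvalues i := by
    rw [sum_norm_sq_column]
    have : Vᴴ * (Xᴴ * X) * V = diagonal (fun i => (h.eigenvalues i : ℂ)) := by
      conv_lhs => rw [hS]
      rw [Matrix.mul_assoc, Matrix.mul_assoc, hV, Matrix.mul_one, ← Matrix.mul_assoc, hV,
        Matrix.one_mul]
    rw [this, diagonal_apply_eq, Complex.ofReal_re]
  have hKi : ∑ k, ‖(K * V) k i‖ ^ 2 ≤ 1 := by
    rw [sum_norm_sq_column]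
    have h0 := (hK.conjTranspose_mul_mul_same V).diag_nonneg (i := i)
    rw [Matrix.mul_sub, Matrix.sub_mul, Matrix.mul_one, hV, sub_apply, one_apply_eq] at h0
    simpa using (Complex.le_def.1 h0).1
  calc (((K * V)ᴴ * (X * V)) i i).re ≤ ∑ k, ‖(K * V) k i‖ * ‖(X * V) k i‖ := by
        rw [Matrix.mul_apply, Complex.re_sum]
        refine Finset.sum_le_sum fun k _ => (Complex.re_le_norm _).trans ?_
        rw [norm_mul, conjTranspose_apply, norm_star]
    _ ≤ √(∑ k, ‖(K * V) k i‖ ^ 2) * √(∑ k, ‖(X * V) k i‖ ^ 2) :=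
        Real.sum_mul_le_sqrt_mul_sqrt _ _ _
    _ ≤ 1 * √(∑ k, ‖(X * V) k i‖ ^ 2) := by
        gcongr
        exact Real.sqrt_le_one.2 hKi
    _ = h.eigenvalues i ^ (1 / 2 : ℝ) := by rw [hXi, one_mul, Real.sqrt_eq_rpow]

/-- The trace norm of `X` is attained by pairing with some contraction. -/
theorem exists_contraction_trace_eq (X : Matrix m n ℂ) :
    ∃ K : Matrix m n ℂ, (1 - Kᴴ * K).PosSemidef ∧
      (Kᴴ * X).trace.re = (matrixRpow (Xᴴ * X) (1 / 2)).trace.re := by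
  have h : (Xᴴ * X).IsHermitian := isHermitian_conjTranspose_mul_self X
  have hpos : ∀ i, 0 ≤ h.eigenvalues i := (posSemidef_conjTranspose_mul_self X).eigenvalues_nonneg
  rw [trace_matrixRpow_re h]
  have hU := conjTranspose_mul_eigenvectorUnitary h
  have hU' := eigenvectorUnitary_mul_conjTranspose h
  have hS := h.eq_eigenvectorUnitary_mul_diagonal
  set U := (h.eigenvectorUnitary : Matrix n n ℂ)
  set L := diagonal (fun i => (h.eigenvalues i : ℂ)) with hL
  set D : Matrix n n ℂ := diagonal (fun i => (((√(h.eigenvalues i))⁻¹ : ℝ) : ℂ)) with hD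
  have hDh : Dᴴ = D := by
    rw [hD, diagonal_conjTranspose]
    congr 1
    ext i
    simp
  have hSU : Xᴴ * X * U = U * L := by
    conv_lhs => rw [hS]
    rw [Matrix.mul_assoc, hU, Matrix.mul_one]
  refine ⟨X * U * D * Uᴴ, ?_, ?_⟩
  · have hK : 1 - (X * U * D * Uᴴ)ᴴ * (X * U * D * Uᴴ) = U * (1 - D * L * D) * Uᴴ := by
      have : (X * U * D * Uᴴ)ᴴ * (X * U * D * Uᴴ) = U * (D * (Uᴴ * (Xᴴ * X * U))) * D * Uᴴ := by
        simp only [conjTranspose_mul, conjTranspose_conjTranspose, hDh, Matrix.mul_assoc]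
      rw [this, hSU, ← Matrix.mul_assoc Uᴴ, hU, Matrix.one_mul, Matrix.mul_sub, Matrix.sub_mul,
        Matrix.mul_one, hU']
      simp only [Matrix.mul_assoc]
    rw [hK]
    refine PosSemidef.mul_mul_conjTranspose_same ?_ U
    rw [hD, hL, diagonal_mul_diagonal, diagonal_mul_diagonal, ← diagonal_one, diagonal_sub,
      posSemidef_diagonal_iff]
    intro i
    rw [← Complex.ofReal_mul, ← Complex.ofReal_mul, ← Complex.ofReal_one, ← Complex.ofReal_sub,
      Complex.zero_le_real]
    rcases (hpos i).eq_or_lt with h0 | h0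
    · simp [← h0]
    · have hs : √(h.eigenvalues i) ≠ 0 := (Real.sqrt_pos.2 h0).ne'
      have : (√(h.eigenvalues i))⁻¹ * h.eigenvalues i * (√(h.eigenvalues i))⁻¹ = 1 := by
        nth_rw 2 [← Real.mul_self_sqrt h0.le]
        field_simp
      rw [this, sub_self]
  · have hK : (X * U * D * Uᴴ)ᴴ * X = U * (D * Uᴴ * (Xᴴ * X)) := by
      simp only [conjTranspose_mul, conjTranspose_conjTranspose, hDh, Matrix.mul_assoc]
    rw [hK, Matrix.trace_mul_comm, Matrix.mul_assoc, hSU, Matrix.mul_assoc, ← Matrix.mul_assoc Uᴴ,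
      hU, Matrix.one_mul, hD, hL, diagonal_mul_diagonal, trace_diagonal, Complex.re_sum]
    refine Finset.sum_congr rfl fun i _ => ?_
    rw [← Complex.ofReal_mul, Complex.ofReal_re, ← Real.sqrt_eq_rpow, mul_comm, ← div_eq_mul_inv,
      Real.div_sqrt]

/-- Convexity of the trace norm `X ↦ Tr (Xᴴ X)^{1/2}` on rectangular matrices. -/
theorem trace_norm_convex (X Y : Matrix m n ℂ) {t : ℝ} (ht0 : 0 ≤ t) (ht1 : t ≤ 1) :
    (matrixRpow ((t • X + (1 - t) • Y)ᴴ * (t • X + (1 - t) • Y)) (1 / 2)).trace.re ≤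
      t * (matrixRpow (Xᴴ * X) (1 / 2)).trace.re +
        (1 - t) * (matrixRpow (Yᴴ * Y) (1 / 2)).trace.re := by
  obtain ⟨K, hK, hKt⟩ := exists_contraction_trace_eq (t • X + (1 - t) • Y)
  rw [← hKt, Matrix.mul_add, Matrix.mul_smul, Matrix.mul_smul, trace_add, trace_smul, trace_smul,
    Complex.add_re, Complex.smul_re, Complex.smul_re, smul_eq_mul, smul_eq_mul]
  exact add_le_add (mul_le_mul_of_nonneg_left (trace_conjTranspose_mul_re_le hK) ht0)
    (mul_le_mul_of_nonneg_left (trace_conjTranspose_mul_re_le hK) (sub_nonneg.2 ht1))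

/-- A sum of squares of Hermitian matrices is the Gram matrix of their vertical stack. -/
theorem sum_matrixRpow_two_eq {ι : Type*} [Fintype ι] (A : ι → Matrix n n ℂ)
    (hA : ∀ j, (A j).IsHermitian) :
    ∑ j, matrixRpow (A j) 2 =
      (of fun (p : ι × n) i => A p.1 p.2 i)ᴴ * of fun (p : ι × n) i => A p.1 p.2 i := by
  ext a b
  rw [Matrix.sum_apply, Matrix.mul_apply, Fintype.sum_prod_type]
  refine Finset.sum_congr rfl fun j _ => ?_
  rw [matrixRpow_two (hA j), Matrix.mul_apply]
  refine Finset.sum_congr rfl fun k _ => ?_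
  rw [conjTranspose_apply, of_apply, of_apply, (hA j).apply]

end Matrix

/-- **Joint convexity of `Φ_2`.**
`Φ_2(A_1,…,A_n) = Tr((∑ A_j^2)^{1/2})` is jointly convex on `n`-tuples of positive
semidefinite `d × d` complex matrices. -/
theorem phi_two_convex {d n : ℕ}
    (A B : Fin n → Matrix (Fin d) (Fin d) ℂ)
    (hA : ∀ j, (A j).PosSemidef) (hB : ∀ j, (B j).PosSemidef)
    (t : ℝ) (ht0 : 0 ≤ t) (ht1 : t ≤ 1) :
    (matrixRpow (∑ j, matrixRpow (t • A j + (1 - t) • B j) 2) (1 / 2)).trace.re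
    ≤ t * (matrixRpow (∑ j, matrixRpow (A j) 2) (1 / 2)).trace.re
      + (1 - t) * (matrixRpow (∑ j, matrixRpow (B j) 2) (1 / 2)).trace.re := by
  have hC : ∀ j, (t • A j + (1 - t) • B j).IsHermitian := fun j =>
    ((hA j).isHermitian.smul (IsSelfAdjoint.all t)).add
      ((hB j).isHermitian.smul (IsSelfAdjoint.all (1 - t)))
  rw [sum_matrixRpow_two_eq _ hC, sum_matrixRpow_two_eq _ fun j => (hA j).isHermitian,
    sum_matrixRpow_two_eq _ fun j => (hB j).isHermitian]
  exact trace_norm_convex (of fun (p : Fin n × Fin d) i => A p.1 p.2 i)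
    (of fun (p : Fin n × Fin d) i => B p.1 p.2 i) ht0 ht1
end

section
/- Let A be a positive semidefinite matrix whose rows and columns are indexed by a product I×J of finite index sets (an operator on ℂ^I ⊗ ℂ^J). Then for every real p ≥ 1, (Tr((Tr_1 A)^p))^{1/p} ≤ Tr((Tr_2 A^p)^{1/p}), where the outer traces are the ordinary traces on ℂ^J and ℂ^I respectively. -/
open Matrix
open scoped ComplexOrder

/-- Partial trace over the first factor: `(Tr₁ A)(j,j') = ∑ i, A((i,j),(i,j'))`. -/
noncomputable def ptraceFst {I J : Type*} [Fintype I]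
    (A : Matrix (I × J) (I × J) ℂ) : Matrix J J ℂ :=
  Matrix.of fun j j' => ∑ i, A (i, j) (i, j')

/-- Partial trace over the second factor: `(Tr₂ A)(i,i') = ∑ j, A((i,j),(i',j))`. -/
noncomputable def ptraceSnd {I J : Type*} [Fintype J]
    (A : Matrix (I × J) (I × J) ℂ) : Matrix I I ℂ :=
  Matrix.of fun i i' => ∑ j, A (i, j) (i', j)

open scoped Kronecker

theorem isHermitian_ptraceFst {I J : Type*} [Fintype I]
    {A : Matrix (I × J) (I × J) ℂ} (hA : A.IsHermitian) : (ptraceFst A).IsHermitian := by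
  ext j j'
  simp only [ptraceFst, conjTranspose_apply, of_apply, star_sum]
  exact Finset.sum_congr rfl fun i _ => hA.apply _ _

theorem isHermitian_ptraceSnd {I J : Type*} [Fintype J]
    {A : Matrix (I × J) (I × J) ℂ} (hA : A.IsHermitian) : (ptraceSnd A).IsHermitian := by
  ext i i'
  simp only [ptraceSnd, conjTranspose_apply, of_apply, star_sum]
  exact Finset.sum_congr rfl fun j _ => hA.apply _ _

theorem isHermitian_matrixRpow {n : Type*} [Fintype n] [DecidableEq n]
    {A : Matrix n n ℂ} (hA : A.IsHermitian) (s : ℝ) : (matrixRpow A s).IsHermitian := by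
  rw [matrixRpow, dif_pos hA]
  refine isHermitian_mul_mul_conjTranspose _ ?_
  exact isHermitian_diagonal_of_self_adjoint _ (by ext i; simp)

/-- The partial trace over the first factor absorbs a local change of orthonormal basis. -/
theorem ptraceFst_conj_kronecker {I J : Type*} [Fintype I] [Fintype J]
    [DecidableEq I] (A : Matrix (I × J) (I × J) ℂ)
    (U : Matrix I I ℂ) (hU : U * Uᴴ = 1) (V : Matrix J J ℂ) :
    ptraceFst ((U ⊗ₖ V)ᴴ * A * (U ⊗ₖ V)) = Vᴴ * ptraceFst A * V := by
  have hdelta (k k' : I) : ∑ i, star (U k i) * U k' i = if k' = k then 1 else 0 := by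
    have := congrFun (congrFun hU k') k
    simpa [mul_apply, one_apply, mul_comm] using this
  ext j j'
  calc _ = ∑ l', ∑ k', ∑ l, ∑ k, (∑ i, star (U k i) * U k' i) *
        (star (V l j) * A (k, l) (k', l') * V l' j') := by
        simp only [ptraceFst, of_apply, mul_apply, conjTranspose_apply, kroneckerMap_apply,
          Fintype.sum_prod_type_right, Finset.sum_mul, star_mul']
        rw [Finset.sum_comm]
        refine Finset.sum_congr rfl fun l' _ => ?_
        rw [Finset.sum_comm]
        refine Finset.sum_congr rfl fun k' _ => ?_
        rw [Finset.sum_comm]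
        refine Finset.sum_congr rfl fun l _ => ?_
        rw [Finset.sum_comm]
        refine Finset.sum_congr rfl fun k _ => Finset.sum_congr rfl fun i _ => ?_
        ring
    _ = _ := by
        simp only [hdelta, ite_mul, one_mul, zero_mul, Finset.sum_ite_eq, Finset.mem_univ, if_true,
          ptraceFst, of_apply, mul_apply, conjTranspose_apply, Finset.sum_mul, Finset.mul_sum]
        refine Finset.sum_congr rfl fun l' _ => Finset.sum_comm

/-- The partial trace over the second factor absorbs a local change of orthonormal basis. -/
theorem ptraceSnd_conj_kronecker {I J : Type*} [Fintype I] [Fintype J]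
    [DecidableEq J] (A : Matrix (I × J) (I × J) ℂ)
    (U : Matrix I I ℂ) (V : Matrix J J ℂ) (hV : V * Vᴴ = 1) :
    ptraceSnd ((U ⊗ₖ V)ᴴ * A * (U ⊗ₖ V)) = Uᴴ * ptraceSnd A * U := by
  have hswap (B : Matrix (I × J) (I × J) ℂ) :
      ptraceSnd B = ptraceFst (B.submatrix (Equiv.prodComm J I) (Equiv.prodComm J I)) := rfl
  have hkron : (U ⊗ₖ V).submatrix (Equiv.prodComm J I) (Equiv.prodComm J I) = V ⊗ₖ U := by
    ext x y
    simp [kroneckerMap_apply, mul_comm]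
  rw [hswap, hswap, ← ptraceFst_conj_kronecker _ V hV U, ← hkron, conjTranspose_submatrix,
    submatrix_mul_equiv, submatrix_mul_equiv]

theorem conj_eigenvectorUnitary {n : Type*} [Fintype n] [DecidableEq n]
    {A : Matrix n n ℂ} (hA : A.IsHermitian) :
    (hA.eigenvectorUnitary : Matrix n n ℂ)ᴴ * A * hA.eigenvectorUnitary =
      diagonal (fun i => (hA.eigenvalues i : ℂ)) := by
  have h := hA.conjStarAlgAut_star_eigenvectorUnitary
  rw [Unitary.conjStarAlgAut_star_apply] at h
  exact h

theorem re_trace_matrixRpow {n : Type*} [Fintype n] [DecidableEq n]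
    {A : Matrix n n ℂ} (hA : A.IsHermitian) (s : ℝ) :
    (matrixRpow A s).trace.re = ∑ i, hA.eigenvalues i ^ s := by
  rw [matrixRpow, dif_pos hA, trace_mul_cycle]
  simp [trace_diagonal]

theorem re_mul_diagonal_mul_conjTranspose_apply {n : Type*} [Fintype n] [DecidableEq n]
    (Q : Matrix n n ℂ) (d : n → ℝ) (k : n) :
    ((Q * diagonal (fun i => (d i : ℂ)) * Qᴴ) k k).re = ∑ m, Complex.normSq (Q k m) * d m := by
  rw [mul_apply, Complex.re_sum]
  refine Finset.sum_congr rfl fun m _ => ?_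
  rw [mul_diagonal, conjTranspose_apply, mul_right_comm, Complex.star_def, Complex.mul_conj,
    ← Complex.ofReal_mul, Complex.ofReal_re]

/-- Jensen's inequality for diagonal entries in an arbitrary orthonormal basis. -/
theorem rpow_re_conj_apply_le {n : Type*} [Fintype n] [DecidableEq n]
    {A : Matrix n n ℂ} (hA : A.PosSemidef) {p : ℝ} (hp : 1 ≤ p)
    (W : Matrix n n ℂ) (hW : Wᴴ * W = 1) (k : n) :
    ((Wᴴ * A * W) k k).re ^ p ≤ ((Wᴴ * matrixRpow A p * W) k k).re := by
  let Z : Matrix n n ℂ := hA.1.eigenvectorUnitary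
  have hZZ : Z * Zᴴ = 1 := Unitary.coe_mul_star_self hA.1.eigenvectorUnitary
  have hAeq : A = Z * diagonal (fun i => (hA.1.eigenvalues i : ℂ)) * Zᴴ := by
    have h := hA.1.spectral_theorem
    rw [Unitary.conjStarAlgAut_apply] at h
    exact h
  have hApow : matrixRpow A p =
      Z * diagonal (fun i => ((hA.1.eigenvalues i ^ p : ℝ) : ℂ)) * Zᴴ := by
    rw [matrixRpow, dif_pos hA.1]
    rfl
  have hconj (D : Matrix n n ℂ) :
      Wᴴ * (Z * D * Zᴴ) * W = (Wᴴ * Z) * D * (Wᴴ * Z)ᴴ := by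
    simp only [conjTranspose_mul, conjTranspose_conjTranspose, Matrix.mul_assoc]
  have hsum : ∑ m, Complex.normSq ((Wᴴ * Z) k m) = 1 := by
    have h := re_mul_diagonal_mul_conjTranspose_apply (Wᴴ * Z) (fun _ => 1) k
    rw [← hconj] at h
    simp only [Complex.ofReal_one, diagonal_one, mul_one] at h
    rw [← h, hZZ, Matrix.mul_one, hW, one_apply_eq, Complex.one_re]
  have hentry : ((Wᴴ * A * W) k k).re =
      ∑ m, Complex.normSq ((Wᴴ * Z) k m) * hA.1.eigenvalues m := by
    rw [← re_mul_diagonal_mul_conjTranspose_apply, ← hconj, ← hAeq]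
  rw [hentry, hApow, hconj, re_mul_diagonal_mul_conjTranspose_apply]
  exact Real.rpow_arith_mean_le_arith_mean_rpow _ _ _ (fun _ _ => Complex.normSq_nonneg _) hsum
    (fun m _ => hA.eigenvalues_nonneg m) hp

/-- Minkowski's inequality for a finite sum of nonnegative finite families. -/
theorem Lp_sum_le_sum_Lp {I J : Type*} [Fintype J] (s : Finset I) (a : I → J → ℝ)
    (ha : ∀ i j, 0 ≤ a i j) {p : ℝ} (hp : 1 ≤ p) :
    (∑ j, (∑ i ∈ s, a i j) ^ p) ^ (1 / p) ≤ ∑ i ∈ s, (∑ j, a i j ^ p) ^ (1 / p) := by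
  classical
  have hp0 : p ≠ 0 := by positivity
  induction s using Finset.induction_on with
  | empty => simp [Real.zero_rpow hp0, Real.zero_rpow (inv_ne_zero hp0)]
  | insert i s hi ih =>
    simp only [Finset.sum_insert hi]
    exact (Real.Lp_add_le_of_nonneg Finset.univ hp (fun j _ => ha i j)
      (fun j _ => Finset.sum_nonneg fun i _ => ha i j)).trans (by gcongr)

/-- **Tracial Minkowski inequality for two spaces, `p ≥ 1`:**
for a positive semidefinite `A` on `ℂ^I ⊗ ℂ^J`,
`(Tr (Tr₁ A)^p)^{1/p} ≤ Tr ((Tr₂ A^p)^{1/p})`. -/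
theorem trace_minkowski_two_factors {I J : Type*} [Fintype I] [Fintype J]
    [DecidableEq I] [DecidableEq J]
    (A : Matrix (I × J) (I × J) ℂ) (hA : A.PosSemidef)
    (p : ℝ) (hp : 1 ≤ p) :
    ((matrixRpow (ptraceFst A) p).trace.re) ^ (1 / p)
      ≤ (matrixRpow (ptraceSnd (matrixRpow A p)) (1 / p)).trace.re := by
  have hF := isHermitian_ptraceFst hA.1
  have hS := isHermitian_ptraceSnd (isHermitian_matrixRpow hA.1 p)
  rw [re_trace_matrixRpow hF, re_trace_matrixRpow hS]
  let V : Matrix J J ℂ := hF.eigenvectorUnitary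
  let U : Matrix I I ℂ := hS.eigenvectorUnitary
  have hVV : V * Vᴴ = 1 := Unitary.coe_mul_star_self hF.eigenvectorUnitary
  have hUU : U * Uᴴ = 1 := Unitary.coe_mul_star_self hS.eigenvectorUnitary
  set W := U ⊗ₖ V with hWdef
  have hW : Wᴴ * W = 1 := by
    rw [hWdef, conjTranspose_kronecker, ← mul_kronecker_mul, mul_eq_one_comm.mp hUU,
      mul_eq_one_comm.mp hVV, one_kronecker_one]
  have hFst (j : J) : hF.eigenvalues j = ∑ i, ((Wᴴ * A * W) (i, j) (i, j)).re := by
    have h := congrFun (congrFun (ptraceFst_conj_kronecker A U hUU V) j) j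
    rw [conj_eigenvectorUnitary hF, diagonal_apply_eq] at h
    simpa [ptraceFst] using (congrArg Complex.re h).symm
  have hSnd (i : I) :
      hS.eigenvalues i = ∑ j, ((Wᴴ * matrixRpow A p * W) (i, j) (i, j)).re := by
    have h := congrFun (congrFun (ptraceSnd_conj_kronecker (matrixRpow A p) U V hVV) i) i
    rw [conj_eigenvectorUnitary hS, diagonal_apply_eq] at h
    simpa [ptraceSnd] using (congrArg Complex.re h).symm
  have hnonneg (i : I) (j : J) : 0 ≤ ((Wᴴ * A * W) (i, j) (i, j)).re :=
    (Complex.nonneg_iff.mp (hA.conjTranspose_mul_mul_same W).diag_nonneg).1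
  simp only [hFst, hSnd]
  refine (Lp_sum_le_sum_Lp Finset.univ _ hnonneg hp).trans ?_
  refine Finset.sum_le_sum fun i _ => Real.rpow_le_rpow ?_ ?_ (by positivity)
  · exact Finset.sum_nonneg fun j _ => Real.rpow_nonneg (hnonneg i j) p
  · exact Finset.sum_le_sum fun j _ => rpow_re_conj_apply_le hA hp W hW (i, j)
end

section
/- Let A be a positive semidefinite matrix whose rows and columns are indexed by a product I×J of finite index sets (an operator on ℂ^I ⊗ ℂ^J). Then for every real p with 0 < p ≤ 1, (Tr((Tr_1 A)^p))^{1/p} ≥ Tr((Tr_2 A^p)^{1/p}), where the outer traces are the ordinary traces on ℂ^J and ℂ^I respectively. -/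
open Matrix
open scoped ComplexOrder

/-- Tensor product of two vectors. -/
def tensorVec {I J : Type*} (u : I → ℂ) (v : J → ℂ) : I × J → ℂ := fun x => u x.1 * v x.2

theorem sum_dotProduct_mulVec_tensorVec_snd {I J : Type*} [Fintype I] [Fintype J] [DecidableEq J]
    (M : Matrix (I × J) (I × J) ℂ) (u : I → ℂ) (V : unitaryGroup J ℂ) :
    ∑ j, star (tensorVec u fun b => V.1 b j) ⬝ᵥ M *ᵥ (tensorVec u fun b => V.1 b j)
      = star u ⬝ᵥ ptraceSnd M *ᵥ u := by
  have hV (b b' : J) : ∑ j, V.1 b' j * star (V.1 b j) = if b' = b then 1 else 0 := by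
    have := congrFun₂ (mem_unitaryGroup_iff.mp V.2) b' b
    simpa [mul_apply, one_apply] using this
  calc _ = ∑ a, ∑ b, ∑ a', ∑ b', star (u a) * M (a, b) (a', b') * u a' *
        ∑ j, V.1 b' j * star (V.1 b j) := by
        simp only [dotProduct, mulVec, tensorVec, Fintype.sum_prod_type, Finset.mul_sum]
        rw [Finset.sum_comm]; refine Finset.sum_congr rfl fun a _ => ?_
        rw [Finset.sum_comm]; refine Finset.sum_congr rfl fun b _ => ?_
        rw [Finset.sum_comm]; refine Finset.sum_congr rfl fun a' _ => ?_
        rw [Finset.sum_comm]; refine Finset.sum_congr rfl fun b' _ => ?_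
        refine Finset.sum_congr rfl fun j _ => ?_
        simp only [Pi.star_apply, tensorVec, star_mul']
        ring
    _ = _ := by
        simp only [hV, mul_ite, mul_one, mul_zero, Finset.sum_ite_eq', Finset.mem_univ, if_true,
          dotProduct, mulVec, ptraceSnd, of_apply, Finset.mul_sum, Finset.sum_mul, Pi.star_apply]
        refine Finset.sum_congr rfl fun a _ => ?_
        rw [Finset.sum_comm]
        simp only [mul_assoc]

theorem sum_dotProduct_mulVec_tensorVec_fst {I J : Type*} [Fintype I] [Fintype J] [DecidableEq I]
    (M : Matrix (I × J) (I × J) ℂ) (v : J → ℂ) (U : unitaryGroup I ℂ) :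
    ∑ i, star (tensorVec (fun a => U.1 a i) v) ⬝ᵥ M *ᵥ (tensorVec (fun a => U.1 a i) v)
      = star v ⬝ᵥ ptraceFst M *ᵥ v := by
  have h := sum_dotProduct_mulVec_tensorVec_snd (M.submatrix Prod.swap Prod.swap) v U
  rw [show ptraceFst M = ptraceSnd (M.submatrix Prod.swap Prod.swap) from rfl, ← h]
  refine Finset.sum_congr rfl fun i _ => ?_
  simp only [dotProduct, mulVec, tensorVec, Fintype.sum_prod_type_right, submatrix_apply,
    Fintype.sum_prod_type (α₁ := J), Prod.swap, Pi.star_apply]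
  simp only [mul_comm (v _)]

theorem star_tensorVec_dotProduct_self {I J : Type*} [Fintype I] [Fintype J]
    (u : I → ℂ) (v : J → ℂ) (hu : star u ⬝ᵥ u = 1) (hv : star v ⬝ᵥ v = 1) :
    star (tensorVec u v) ⬝ᵥ tensorVec u v = 1 := by
  calc _ = (star u ⬝ᵥ u) * (star v ⬝ᵥ v) := by
        simp only [dotProduct, tensorVec, Fintype.sum_prod_type, Finset.sum_mul_sum,
          Pi.star_apply, star_mul']
        exact Finset.sum_congr rfl fun a _ => Finset.sum_congr rfl fun b _ => by ring
    _ = 1 := by rw [hu, hv, one_mul]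

theorem star_col_dotProduct_col {n : Type*} [Fintype n] [DecidableEq n] (U : unitaryGroup n ℂ)
    (i : n) : star (fun a => U.1 a i) ⬝ᵥ (fun a => U.1 a i) = 1 := by
  have := congrFun₂ (mem_unitaryGroup_iff'.mp U.2) i i
  simpa [mul_apply, dotProduct] using this

section matrixRpow

variable {n : Type*} [Fintype n] [DecidableEq n] {A : Matrix n n ℂ}

theorem Matrix.IsHermitian.trace_matrixRpow (h : A.IsHermitian) (s : ℝ) :
    (matrixRpow A s).trace.re = ∑ i, h.eigenvalues i ^ s := by
  rw [matrixRpow, dif_pos h, trace_mul_comm, ← mul_assoc]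
  simp [trace_diagonal]

theorem Matrix.IsHermitian.matrixRpow (h : A.IsHermitian) (s : ℝ) :
    (matrixRpow A s).IsHermitian := by
  rw [_root_.matrixRpow, dif_pos h]
  refine isHermitian_mul_mul_conjTranspose _ ?_
  exact isHermitian_diagonal_iff.mpr fun i => by simp [IsSelfAdjoint]

theorem Matrix.IsHermitian.matrixRpow_one (h : A.IsHermitian) : _root_.matrixRpow A 1 = A := by
  rw [_root_.matrixRpow, dif_pos h]
  conv_rhs => rw [h.spectral_theorem]
  simp [Unitary.conjStarAlgAut_apply, Function.comp_def]

theorem Matrix.IsHermitian.dotProduct_matrixRpow_mulVec (h : A.IsHermitian) (s : ℝ) (w : n → ℂ) :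
    (star w ⬝ᵥ _root_.matrixRpow A s *ᵥ w).re
      = ∑ k, ‖((star h.eigenvectorUnitary : Matrix n n ℂ) *ᵥ w) k‖ ^ 2 * h.eigenvalues k ^ s := by
  rw [_root_.matrixRpow, dif_pos h, ← mulVec_mulVec, ← mulVec_mulVec, dotProduct_mulVec]
  have : star w ᵥ* (h.eigenvectorUnitary : Matrix n n ℂ)
      = star ((star h.eigenvectorUnitary : Matrix n n ℂ) *ᵥ w) := by
    rw [star_mulVec]; simp [star_eq_conjTranspose]
  rw [this, dotProduct, Complex.re_sum]
  refine Finset.sum_congr rfl fun k _ => ?_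
  rw [mulVec_diagonal, Pi.star_apply, mul_left_comm, Complex.star_def, Complex.conj_mul',
    mul_comm, ← Complex.ofReal_pow, ← Complex.ofReal_mul, Complex.ofReal_re]

theorem Matrix.PosSemidef.dotProduct_matrixRpow_mulVec_nonneg (hA : A.PosSemidef) (s : ℝ)
    (w : n → ℂ) : 0 ≤ (star w ⬝ᵥ matrixRpow A s *ᵥ w).re := by
  rw [hA.1.dotProduct_matrixRpow_mulVec]
  exact Finset.sum_nonneg fun k _ =>
    mul_nonneg (by positivity) (Real.rpow_nonneg (hA.eigenvalues_nonneg k) _)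

theorem Matrix.PosSemidef.dotProduct_matrixRpow_mulVec_le (hA : A.PosSemidef) {p : ℝ}
    (hp0 : 0 ≤ p) (hp1 : p ≤ 1) (w : n → ℂ) (hw : star w ⬝ᵥ w = 1) :
    (star w ⬝ᵥ matrixRpow A p *ᵥ w).re ≤ (star w ⬝ᵥ A *ᵥ w).re ^ p := by
  have h1 := hA.1.dotProduct_matrixRpow_mulVec 1 w
  have h0 := hA.1.dotProduct_matrixRpow_mulVec 0 w
  rw [hA.1.matrixRpow_one] at h1
  have hI : matrixRpow A 0 = 1 := by
    rw [matrixRpow, dif_pos hA.1]; simp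
  rw [hI, one_mulVec, hw] at h0
  simp only [Real.rpow_one, Real.rpow_zero, mul_one, Complex.one_re] at h0 h1
  rw [hA.1.dotProduct_matrixRpow_mulVec, h1]
  have := (Real.concaveOn_rpow hp0 hp1).le_map_sum (t := Finset.univ)
    (w := fun k => ‖((star hA.1.eigenvectorUnitary : Matrix n n ℂ) *ᵥ w) k‖ ^ 2)
    (p := hA.1.eigenvalues) (fun _ _ => by positivity) h0.symm
    (fun k _ => hA.eigenvalues_nonneg k)
  simpa only [smul_eq_mul] using this

theorem Matrix.IsHermitian.eigenvalues_eq_dotProduct_col (h : A.IsHermitian) (i : n) :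
    h.eigenvalues i = (star (fun a => h.eigenvectorUnitary.1 a i) ⬝ᵥ
      A *ᵥ (fun a => h.eigenvectorUnitary.1 a i)).re :=
  h.eigenvalues_eq i

end matrixRpow

/-- Minkowski's inequality for a finite family of nonnegative vectors. -/
theorem Real.Lp_sum_le_of_nonneg {ι κ : Type*} (s : Finset ι) (t : Finset κ) {q : ℝ} (hq : 1 ≤ q)
    (f : ι → κ → ℝ) (hf : ∀ i j, 0 ≤ f i j) :
    (∑ i ∈ s, (∑ j ∈ t, f i j) ^ q) ^ (1 / q) ≤ ∑ j ∈ t, (∑ i ∈ s, f i j ^ q) ^ (1 / q) := by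
  classical
  have hq0 : q ≠ 0 := by positivity
  induction t using Finset.induction_on with
  | empty => simp [Real.zero_rpow hq0, Real.zero_rpow (inv_ne_zero hq0)]
  | insert j t hj ih =>
    simp only [Finset.sum_insert hj]
    refine (Real.Lp_add_le_of_nonneg s hq (fun i _ => hf i j)
      (fun i _ => Finset.sum_nonneg fun j _ => hf i j)).trans ?_
    gcongr

/-- Minkowski's inequality for exponents in `(0, 1]`, with the order of summation exchanged. -/
theorem Real.sum_rpow_sum_rpow_le {ι κ : Type*} (s : Finset ι) (t : Finset κ) {p : ℝ} (hp0 : 0 < p)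
    (hp1 : p ≤ 1) (a : ι → κ → ℝ) (ha : ∀ i j, 0 ≤ a i j) :
    ∑ i ∈ s, (∑ j ∈ t, a i j ^ p) ^ (1 / p) ≤ (∑ j ∈ t, (∑ i ∈ s, a i j) ^ p) ^ (1 / p) := by
  have h := Real.Lp_sum_le_of_nonneg s t (one_le_one_div hp0 hp1) (fun i j => a i j ^ p)
    (fun i j => Real.rpow_nonneg (ha i j) p)
  have hinv (i j) : (a i j ^ p) ^ (1 / p) = a i j := by
    rw [one_div, Real.rpow_rpow_inv (ha i j) hp0.ne']
  simp only [hinv, one_div_one_div] at h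
  have h0 : 0 ≤ ∑ i ∈ s, (∑ j ∈ t, a i j ^ p) ^ (1 / p) :=
    Finset.sum_nonneg fun i _ => Real.rpow_nonneg
      (Finset.sum_nonneg fun j _ => Real.rpow_nonneg (ha i j) p) _
  have h1 : 0 ≤ ∑ j ∈ t, (∑ i ∈ s, a i j) ^ p :=
    Finset.sum_nonneg fun j _ => Real.rpow_nonneg (Finset.sum_nonneg fun i _ => ha i j) p
  have h2 := (Real.le_rpow_inv_iff_of_pos h0 h1 hp0).mpr h
  rwa [← one_div] at h2

theorem Matrix.IsHermitian.ptraceSnd {I J : Type*} [Fintype J] {M : Matrix (I × J) (I × J) ℂ}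
    (h : M.IsHermitian) : (ptraceSnd M).IsHermitian :=
  IsHermitian.ext fun i i' => by simp [_root_.ptraceSnd, h.apply]

theorem Matrix.IsHermitian.ptraceFst {I J : Type*} [Fintype I] {M : Matrix (I × J) (I × J) ℂ}
    (h : M.IsHermitian) : (ptraceFst M).IsHermitian :=
  IsHermitian.ext fun i i' => by simp [_root_.ptraceFst, h.apply]

/-- **Tracial Minkowski inequality for two spaces, `0 < p ≤ 1` (reversed):**
for a positive semidefinite `A` on `ℂ^I ⊗ ℂ^J`,
`(Tr (Tr₁ A)^p)^{1/p} ≥ Tr ((Tr₂ A^p)^{1/p})`. -/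
theorem trace_minkowski_two_factors_reversed {I J : Type*} [Fintype I] [Fintype J]
    [DecidableEq I] [DecidableEq J]
    (A : Matrix (I × J) (I × J) ℂ) (hA : A.PosSemidef)
    (p : ℝ) (hp0 : 0 < p) (hp1 : p ≤ 1) :
    (matrixRpow (ptraceSnd (matrixRpow A p)) (1 / p)).trace.re
      ≤ ((matrixRpow (ptraceFst A) p).trace.re) ^ (1 / p) := by
  have hC := (hA.1.matrixRpow p).ptraceSnd
  have hB := hA.1.ptraceFst
  set U := hC.eigenvectorUnitary
  set V := hB.eigenvectorUnitary
  let w (i : I) (j : J) : I × J → ℂ := tensorVec (fun a => U.1 a i) (fun b => V.1 b j)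
  let a (i : I) (j : J) : ℝ := (star (w i j) ⬝ᵥ A *ᵥ w i j).re
  have ha (i j) : 0 ≤ a i j := by
    simpa only [hA.1.matrixRpow_one] using hA.dotProduct_matrixRpow_mulVec_nonneg 1 (w i j)
  have hCe (i : I) : hC.eigenvalues i
      = ∑ j, (star (w i j) ⬝ᵥ matrixRpow A p *ᵥ w i j).re := by
    rw [hC.eigenvalues_eq_dotProduct_col, ← sum_dotProduct_mulVec_tensorVec_snd _ _ V,
      Complex.re_sum]
  have hBe (j : J) : hB.eigenvalues j = ∑ i, a i j := by
    rw [hB.eigenvalues_eq_dotProduct_col, ← sum_dotProduct_mulVec_tensorVec_fst _ _ U,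
      Complex.re_sum]
  have hle (i : I) : hC.eigenvalues i ≤ ∑ j, a i j ^ p := by
    rw [hCe]
    exact Finset.sum_le_sum fun j _ => hA.dotProduct_matrixRpow_mulVec_le hp0.le hp1 _
      (star_tensorVec_dotProduct_self _ _ (star_col_dotProduct_col U i)
        (star_col_dotProduct_col V j))
  have hC0 (i : I) : 0 ≤ hC.eigenvalues i := by
    rw [hCe]
    exact Finset.sum_nonneg fun j _ => hA.dotProduct_matrixRpow_mulVec_nonneg p _
  rw [hC.trace_matrixRpow, hB.trace_matrixRpow]
  calc ∑ i, hC.eigenvalues i ^ (1 / p)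
      ≤ ∑ i, (∑ j, a i j ^ p) ^ (1 / p) := Finset.sum_le_sum fun i _ =>
        Real.rpow_le_rpow (hC0 i) (hle i) (by positivity)
    _ ≤ (∑ j, (∑ i, a i j) ^ p) ^ (1 / p) :=
        Real.sum_rpow_sum_rpow_le _ _ hp0 hp1 a ha
    _ = (∑ j, hB.eigenvalues j ^ p) ^ (1 / p) := by simp only [hBe]
end
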